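/- Let 0<α<1, 1<p<1/α, and let q satisfy 1/p − 1/q − α = 0. There exists a constant c depending only on p and α such that for every weight w ∈ A_{p,q}^-(ℝ), ‖w·M⁻_α f‖_{L^q(ℝ)} ≤ c ‖w‖_{A_{p,q}^-(ℝ)}^{(p'/q)(1-α)} ‖w f‖_{L^p(ℝ)} for all f with wf ∈ L^p(ℝ); i.e. ‖M⁻_α‖_{L^p_{w^p}→L^q_{w^q}} ≤ c‖w‖_{A_{p,q}^-(ℝ)}^{(p'/q)(1-α)}. -/

import Mathlib

open MeasureTheory Set Filter
open scoped ENNReal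

noncomputable section

/-- A weight on `ℝ`: an a.e. positive, locally integrable function. -/
def IsWeight (w : ℝ → ℝ) : Prop :=
  (∀ᵐ x : ℝ, 0 < w x) ∧ MeasureTheory.LocallyIntegrable w MeasureTheory.volume

/-- `∫_a^b w` as a lower integral. -/
def lintIoc (w : ℝ → ℝ) (a b : ℝ) : ℝ≥0∞ :=
  ∫⁻ t in Set.Ioc a b, ENNReal.ofReal (w t)

/-- Average `(1/(b-a)) ∫_a^b w`. -/
def avgIoc (w : ℝ → ℝ) (a b : ℝ) : ℝ≥0∞ :=
  (ENNReal.ofReal (b - a))⁻¹ * lintIoc w a b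

/-- The one-sided `A_{p,q}^-` characteristic:
`sup_{x,h>0} ((1/h)∫_x^{x+h} u^q)((1/h)∫_{x-h}^x u^{-p'})^{q/p'}`, `p' = p/(p-1)`. -/
def apqMinusChar (p q : ℝ) (u : ℝ → ℝ) : ℝ≥0∞ :=
  ⨆ (x : ℝ) (h : ℝ) (_ : 0 < h),
    avgIoc (fun t => u t ^ q) x (x + h) *
      avgIoc (fun t => u t ^ (-(p / (p - 1)))) (x - h) x ^ (q / (p / (p - 1)))

/-- Weighted `L^p` "norm" `(∫ g^p w)^{1/p}` of an `ℝ≥0∞`-valued function. -/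
def lnormW (p : ℝ) (w : ℝ → ℝ) (g : ℝ → ℝ≥0∞) : ℝ≥0∞ :=
  (∫⁻ x : ℝ, g x ^ p * ENNReal.ofReal (w x)) ^ (1 / p)

/-- One-sided fractional maximal operator
`M⁻_α f(x) = sup_{h>0} h^{α-1} ∫_{x-h}^x |f|`. -/
def MminusAlpha (α : ℝ) (f : ℝ → ℝ) (x : ℝ) : ℝ≥0∞ :=
  ⨆ (h : ℝ) (_ : 0 < h),
    ENNReal.ofReal (h ^ (α - 1)) * ∫⁻ t in Set.Ioc (x - h) x, ENNReal.ofReal |f t|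

/-- a measurable minorant with the same interval integrals -/
lemma ex_minorant (F : ℝ → ℝ≥0∞) : ∃ F0 : ℝ → ℝ≥0∞, Measurable F0 ∧ (∀ x, F0 x ≤ F x) ∧
    ∀ a b : ℝ, ∫⁻ t in Ioc a b, F t ≤ ∫⁻ t in Ioc a b, F0 t := by
  have H : ∀ I : ℚ × ℚ, ∃ g : ℝ → ℝ≥0∞, Measurable g ∧ g ≤ F ∧
      ∫⁻ t in Ioc (I.1:ℝ) I.2, F t = ∫⁻ t in Ioc (I.1:ℝ) I.2, g t := fun I =>
    exists_measurable_le_lintegral_eq (μ := volume.restrict (Ioc (I.1:ℝ) I.2)) F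
  choose G hG1 hG2 hG3 using H
  refine ⟨fun x => ⨆ I, G I x, Measurable.iSup hG1, fun x => iSup_le fun I => hG2 I x, ?_⟩
  intro a b
  rcases le_or_gt b a with hab | hab
  · simp [hab]
  obtain ⟨v, hv1, hv2, hv3⟩ := Real.exists_seq_rat_strictMono_tendsto b
  obtain ⟨l, hl1, hl2, hl3⟩ := Real.exists_seq_rat_strictAnti_tendsto a
  have hU : Ioo a b = ⋃ n, Ioc (l n : ℝ) (v n) := by
    ext y
    simp only [mem_Ioo, mem_iUnion, mem_Ioc]
    constructor
    · rintro ⟨h1, h2⟩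
      have e1 := hl3.eventually_lt_const h1
      have e2 := hv3.eventually_const_lt h2
      obtain ⟨n, hn1, hn2⟩ := (e1.and e2).exists
      exact ⟨n, hn1, hn2.le⟩
    · rintro ⟨n, h1, h2⟩
      exact ⟨(hl2 n).trans h1, h2.trans_lt (hv2 n)⟩
  have hm : Monotone fun n => Ioc (l n : ℝ) (v n) := by
    intro m n hmn
    apply Ioc_subset_Ioc
    · exact_mod_cast hl1.antitone hmn
    · exact_mod_cast hv1.monotone hmn
  rw [setLIntegral_congr (Ioo_ae_eq_Ioc (μ := volume) (a := a) (b := b)).symm,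
    setLIntegral_congr (Ioo_ae_eq_Ioc (μ := volume) (a := a) (b := b)).symm]
  rw [← withDensity_apply F measurableSet_Ioo, hU, hm.measure_iUnion]
  refine iSup_le fun n => ?_
  rw [withDensity_apply F measurableSet_Ioc, hG3 (l n, v n)]
  refine (lintegral_mono fun x => le_iSup (fun I => G I x) (l n, v n)).trans ?_
  exact lintegral_mono_set (subset_iUnion (fun n => Ioc (l n : ℝ) (v n)) n)

/-- finite subcover of multiplicity at most two -/
lemma cover2 (S : Finset (ℚ × ℚ)) : ∃ T ⊆ S,
    (∀ I ∈ S, ∀ y : ℝ, y ∈ Ioc (I.1:ℝ) I.2 → ∃ J ∈ T, y ∈ Ioc (J.1:ℝ) J.2) ∧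
    ∀ y : ℝ, ∑ J ∈ T, (Ioc (J.1:ℝ) J.2).indicator (fun _ => (1:ℝ≥0∞)) y ≤ 2 := by
  classical
  induction hn : S.card using Nat.strong_induction_on generalizing S with
  | _ n ih =>
  by_cases hk : ∃ k ∈ S, ∀ y : ℝ, y ∈ Ioc (k.1:ℝ) k.2 → ∃ J ∈ S.erase k, y ∈ Ioc (J.1:ℝ) J.2
  · obtain ⟨k, hkS, hk⟩ := hk
    obtain ⟨T, hT1, hT2, hT3⟩ := ih _ (hn ▸ Finset.card_erase_lt_of_mem hkS) (S.erase k) rfl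
    refine ⟨T, hT1.trans (Finset.erase_subset _ _), ?_, hT3⟩
    intro I hI y hy
    by_cases h : I = k
    · subst h
      obtain ⟨J, hJ, hJy⟩ := hk y hy
      exact hT2 J hJ y hJy
    · exact hT2 I (Finset.mem_erase.2 ⟨h, hI⟩) y hy
  · refine ⟨S, subset_rfl, fun I hI y hy => ⟨I, hI, hy⟩, fun y => ?_⟩
    set T := S.filter (fun J => y ∈ Ioc (J.1:ℝ) J.2) with hT
    have e : ∑ J ∈ S, (Ioc (J.1:ℝ) J.2).indicator (fun _ => (1:ℝ≥0∞)) y = (T.card : ℝ≥0∞) := by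
      simp only [indicator_apply]
      rw [Finset.sum_ite]
      simp [hT]
    rw [e]
    rcases T.eq_empty_or_nonempty with h0 | h0
    · simp [h0]
    obtain ⟨i, hi, hi'⟩ := T.exists_min_image (fun J => J.1) h0
    obtain ⟨j, hj, hj'⟩ := T.exists_max_image (fun J => J.2) h0
    have hsub : T ⊆ {i, j} := by
      intro k hkT
      by_contra hne
      simp only [Finset.mem_insert, Finset.mem_singleton, not_or] at hne
      apply hk
      have hkS : k ∈ S := (Finset.mem_filter.1 hkT).1
      refine ⟨k, hkS, fun z hz => ?_⟩
      have hi1 := (Finset.mem_filter.1 hi)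
      have hj1 := (Finset.mem_filter.1 hj)
      have a1 : (i.1:ℝ) ≤ k.1 := by exact_mod_cast hi' k hkT
      have a2 : (k.2:ℝ) ≤ j.2 := by exact_mod_cast hj' k hkT
      rcases le_or_gt z y with hzy | hzy
      · exact ⟨i, Finset.mem_erase.2 ⟨fun h => hne.1 h.symm, hi1.1⟩,
          a1.trans_lt hz.1, hzy.trans hi1.2.2⟩
      · exact ⟨j, Finset.mem_erase.2 ⟨fun h => hne.2 h.symm, hj1.1⟩,
          hj1.2.1.trans hzy, hz.2.trans a2⟩
    have := (Finset.card_le_card hsub).trans Finset.card_le_two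
    exact_mod_cast this

/-- noncentered maximal function over rational intervals -/
def mx (μ : Measure ℝ) (F : ℝ → ℝ≥0∞) (x : ℝ) : ℝ≥0∞ :=
  ⨆ I : ℚ × ℚ, (Ioc (I.1:ℝ) I.2).indicator
    (fun _ => (∫⁻ t in Ioc (I.1:ℝ) I.2, F t ∂μ) / μ (Ioc (I.1:ℝ) I.2)) x

lemma mx_meas (μ : Measure ℝ) (F : ℝ → ℝ≥0∞) : Measurable (mx μ F) :=
  Measurable.iSup fun _ => measurable_const.indicator measurableSet_Ioc

lemma mx_weak (μ : Measure ℝ) (F : ℝ → ℝ≥0∞) (hF : Measurable F) (c : ℝ≥0∞) :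
    c * μ {x | c < mx μ F x} ≤ 2 * ∫⁻ t, F t ∂μ := by
  classical
  set A : Set (ℚ × ℚ) := {I | c * μ (Ioc (I.1:ℝ) I.2) ≤ ∫⁻ t in Ioc (I.1:ℝ) I.2, F t ∂μ} with hA
  have hsub : {x | c < mx μ F x} ⊆ ⋃ I : A, Ioc (I.1.1:ℝ) I.1.2 := by
    intro x hx
    obtain ⟨I, hI⟩ := lt_iSup_iff.1 (show c < mx μ F x from hx)
    by_cases hxI : x ∈ Ioc (I.1:ℝ) I.2
    · rw [indicator_of_mem hxI] at hI
      exact mem_iUnion.2 ⟨⟨I, ENNReal.mul_le_of_le_div hI.le⟩, hxI⟩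
    · rw [indicator_of_notMem hxI] at hI
      simp at hI
  refine (mul_le_mul_right (measure_mono hsub) c).trans ?_
  have hfin : ∀ S : Finset (ℚ × ℚ), (∀ I ∈ S, I ∈ A) →
      c * μ (⋃ I ∈ S, Ioc (I.1:ℝ) I.2) ≤ 2 * ∫⁻ t, F t ∂μ := by
    intro S hS
    obtain ⟨T, hT1, hT2, hT3⟩ := cover2 S
    have h1 : (⋃ I ∈ S, Ioc (I.1:ℝ) I.2) ⊆ ⋃ I ∈ T, Ioc (I.1:ℝ) I.2 := by
      intro y hy
      simp only [mem_iUnion] at hy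
      obtain ⟨I, hI, hy⟩ := hy
      obtain ⟨J, hJ, hy⟩ := hT2 I hI y hy
      exact mem_biUnion hJ hy
    calc c * μ (⋃ I ∈ S, Ioc (I.1:ℝ) I.2) ≤ c * ∑ I ∈ T, μ (Ioc (I.1:ℝ) I.2) := by
          gcongr
          exact (measure_mono h1).trans (measure_biUnion_finset_le _ _)
      _ = ∑ I ∈ T, c * μ (Ioc (I.1:ℝ) I.2) := Finset.mul_sum _ _ _
      _ ≤ ∑ I ∈ T, ∫⁻ t in Ioc (I.1:ℝ) I.2, F t ∂μ :=
          Finset.sum_le_sum fun I hI => hS I (hT1 hI)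
      _ = ∑ I ∈ T, ∫⁻ t, (Ioc (I.1:ℝ) I.2).indicator (fun _ => 1) t * F t ∂μ := by
          refine Finset.sum_congr rfl fun I _ => ?_
          rw [← lintegral_indicator measurableSet_Ioc]
          refine lintegral_congr fun t => ?_
          by_cases h : t ∈ Ioc (I.1:ℝ) I.2 <;> simp [h]
      _ = ∫⁻ t, ∑ I ∈ T, (Ioc (I.1:ℝ) I.2).indicator (fun _ => 1) t * F t ∂μ := by
          rw [lintegral_finsetSum]
          intro I _
          exact (measurable_const.indicator measurableSet_Ioc).mul hF
      _ ≤ ∫⁻ t, 2 * F t ∂μ := by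
          refine lintegral_mono fun t => ?_
          simp only [← Finset.sum_mul]
          gcongr
          exact hT3 t
      _ = 2 * ∫⁻ t, F t ∂μ := lintegral_const_mul _ hF
  rw [iUnion_eq_iUnion_finset, Directed.measure_iUnion, ENNReal.mul_iSup]
  · refine iSup_le fun S => ?_
    have := hfin (S.image Subtype.val) (by
      intro I hI
      obtain ⟨J, _, rfl⟩ := Finset.mem_image.1 hI
      exact J.2)
    rwa [Finset.set_biUnion_finset_image] at this
  · refine Monotone.directed_le fun S T hST => ?_
    exact biUnion_subset_biUnion_left hST

lemma mx_ge (μ : Measure ℝ) [IsLocallyFiniteMeasure μ] (hna : ∀ x, μ {x} = 0)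
    (F : ℝ → ℝ≥0∞) (a x y : ℝ)
    (h0 : μ (Ioc a x) ≠ 0) (hy : y ∈ Ioc a x) :
    (∫⁻ t in Ioc a x, F t ∂μ) / μ (Ioc a x) ≤ mx μ F y := by
  have hax : a < x := hy.1.trans_le hy.2
  refine le_of_forall_lt_imp_le_of_dense fun c hc => ?_
  rcases eq_or_ne c 0 with hc0 | hc0
  · simp [hc0]
  have hct : c ≠ ∞ := hc.ne_top
  have h1 : c * μ (Ioc a x) < ∫⁻ t in Ioc a x, F t ∂μ :=
    ENNReal.mul_lt_of_lt_div hc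
  have h2 : μ (Icc a x) < (∫⁻ t in Ioc a x, F t ∂μ) / c := by
    have : μ (Icc a x) ≤ μ (Ioc a x) := by
      have e : Icc a x = {a} ∪ Ioc a x := by
        rw [singleton_union, Ioc_insert_left hax.le]
      rw [e]
      refine (measure_union_le _ _).trans ?_
      rw [hna, zero_add]
    refine this.trans_lt ?_
    rw [ENNReal.lt_div_iff_mul_lt (Or.inl hc0) (Or.inl hct), mul_comm]
    exact h1
  obtain ⟨U, hU1, hU2, hU3⟩ := (Icc a x).exists_isOpen_lt_of_lt _ h2
  obtain ⟨a1, ha1, ha2⟩ := exists_Ioc_subset_of_mem_nhds (hU2.mem_nhds (hU1 (left_mem_Icc.2 hax.le)))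
    ⟨a - 1, by linarith⟩
  obtain ⟨b1, hb1, hb2⟩ := exists_Ico_subset_of_mem_nhds (hU2.mem_nhds (hU1 (right_mem_Icc.2 hax.le)))
    ⟨x + 1, by linarith⟩
  obtain ⟨a', ha3, ha4⟩ := exists_rat_btwn ha1
  obtain ⟨b', hb3, hb4⟩ := exists_rat_btwn hb1
  have hsub : Ioc (a':ℝ) b' ⊆ U := by
    intro z hz
    rcases le_or_gt z a with h | h
    · exact ha2 ⟨ha3.trans hz.1, h⟩
    rcases le_or_gt z x with h' | h'
    · exact hU1 ⟨h.le, h'⟩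
    · exact hb2 ⟨h'.le, hz.2.trans_lt hb4⟩
  have hsup : Ioc a x ⊆ Ioc (a':ℝ) b' := Ioc_subset_Ioc ha4.le hb3.le
  have h3 : μ (Ioc (a':ℝ) b') < (∫⁻ t in Ioc a x, F t ∂μ) / c := (measure_mono hsub).trans_lt hU3
  have h4 : c ≤ (∫⁻ t in Ioc (a':ℝ) b', F t ∂μ) / μ (Ioc (a':ℝ) b') := by
    rw [ENNReal.le_div_iff_mul_le (Or.inl (fun h => h0 (measure_mono_null hsup h)))
      (Or.inl h3.ne_top)]
    have := ENNReal.mul_le_of_le_div h3.le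
    rw [mul_comm]
    exact this.trans (lintegral_mono_set hsup)
  refine h4.trans ?_
  refine le_trans ?_ (le_iSup _ (a', b'))
  rw [indicator_of_mem (hsup hy)]

lemma layer (b : ℝ) (hb : 0 < b) (t : ℝ≥0∞) :
    ∫⁻ l in Ioi (0:ℝ), {l : ℝ | ENNReal.ofReal l < t}.indicator
      (fun l => ENNReal.ofReal (l ^ (b - 1))) l = ENNReal.ofReal b⁻¹ * t ^ b := by
  have key : ∀ s : ℝ, 0 ≤ s → ∫⁻ l in Ioi (0:ℝ), {l : ℝ | ENNReal.ofReal l < ENNReal.ofReal s}.indicator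
      (fun l => ENNReal.ofReal (l ^ (b - 1))) l = ENNReal.ofReal b⁻¹ * (ENNReal.ofReal s) ^ b := by
    intro s hs
    have hm : MeasurableSet {l : ℝ | ENNReal.ofReal l < ENNReal.ofReal s} :=
      measurableSet_lt ENNReal.measurable_ofReal measurable_const
    rw [lintegral_indicator hm, Measure.restrict_restrict hm]
    have e : {l : ℝ | ENNReal.ofReal l < ENNReal.ofReal s} ∩ Ioi 0 = Ioo 0 s := by
      ext l
      simp only [mem_inter_iff, mem_ofPred_eq, mem_Ioi, mem_Ioo]
      constructor
      · rintro ⟨h1, h2⟩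
        exact ⟨h2, (ENNReal.ofReal_lt_ofReal_iff_of_nonneg h2.le).1 h1⟩
      · rintro ⟨h1, h2⟩
        exact ⟨(ENNReal.ofReal_lt_ofReal_iff_of_nonneg h1.le).2 h2, h1⟩
    rw [e, setLIntegral_congr (Ioo_ae_eq_Ioc (μ := volume) (a := (0:ℝ)) (b := s)),
      ← ofReal_integral_eq_lintegral_ofReal, ← intervalIntegral.integral_of_le hs,
      integral_rpow (Or.inl (by linarith)), ENNReal.ofReal_rpow_of_nonneg hs hb.le,
      ← ENNReal.ofReal_mul (by positivity)]
    · congr 1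
      rw [sub_add_cancel, Real.zero_rpow hb.ne']
      field_simp
      simp
    · exact (intervalIntegrable_iff_integrableOn_Ioc_of_le hs).1
        (intervalIntegral.intervalIntegrable_rpow' (by linarith))
    · refine (ae_restrict_iff' measurableSet_Ioc).2 (ae_of_all _ fun l hl => ?_)
      exact Real.rpow_nonneg hl.1.le _
  rcases eq_or_ne t ∞ with ht | ht
  · subst ht
    rw [ENNReal.top_rpow_of_pos hb, ENNReal.mul_top (by simpa using hb)]
    refine ENNReal.eq_top_of_forall_nnreal_le fun r => ?_
    have h := key ((b * r) ^ b⁻¹) (by positivity)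
    rw [ENNReal.ofReal_rpow_of_nonneg (by positivity) hb.le, ← ENNReal.ofReal_mul (by positivity),
      ← Real.rpow_mul (by positivity), inv_mul_cancel₀ hb.ne', Real.rpow_one,
      inv_mul_cancel_left₀ hb.ne'] at h
    rw [← ENNReal.ofReal_coe_nnreal, ← h]
    refine lintegral_mono fun l => ?_
    refine indicator_le_indicator_of_subset ?_ (fun _ => zero_le) l
    intro l _
    exact ENNReal.ofReal_lt_top
  · have := key t.toReal ENNReal.toReal_nonneg
    rwa [ENNReal.ofReal_toReal ht] at this

lemma mx_trunc (μ : Measure ℝ) (F : ℝ → ℝ≥0∞) (hF : Measurable F) (c : ℝ≥0∞) (x : ℝ) :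
    mx μ F x ≤ mx μ ({y | c < F y}.indicator F) x + c := by
  have hm : MeasurableSet {y | c < F y} := measurableSet_lt measurable_const hF
  refine iSup_le fun I => ?_
  by_cases hx : x ∈ Ioc (I.1:ℝ) I.2
  · have h1 : ∫⁻ t in Ioc (I.1:ℝ) I.2, F t ∂μ ≤
        ∫⁻ t in Ioc (I.1:ℝ) I.2, {y | c < F y}.indicator F t ∂μ + c * μ (Ioc (I.1:ℝ) I.2) := by
      rw [← setLIntegral_const, ← lintegral_add_right _ measurable_const]
      refine lintegral_mono fun t => ?_
      by_cases ht : c < F t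
      · rw [indicator_of_mem (show t ∈ {y | c < F y} from ht)]
        exact le_self_add
      · rw [indicator_of_notMem (show t ∉ {y | c < F y} from ht), zero_add]
        exact not_lt.1 ht
    rw [indicator_of_mem hx]
    refine (ENNReal.div_le_div_right h1 _).trans ?_
    rw [ENNReal.add_div]
    refine add_le_add ?_ ?_
    · refine le_trans ?_ (le_iSup _ I)
      rw [indicator_of_mem hx]
    · rw [mul_div_assoc]
      exact mul_le_of_le_one_right' ENNReal.div_self_le_one
  · rw [indicator_of_notMem hx]
    exact zero_le

lemma mx_strong (s : ℝ) (hs : 1 < s) : ∃ C : ℝ≥0∞, C ≠ ∞ ∧ ∀ (μ : Measure ℝ) [SFinite μ]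
    (F : ℝ → ℝ≥0∞), Measurable F → ∫⁻ x, mx μ F x ^ s ∂μ ≤ C * ∫⁻ x, F x ^ s ∂μ := by
  refine ⟨2 ^ s * (ENNReal.ofReal s * (2 * ENNReal.ofReal (s - 1)⁻¹)), ?_, ?_⟩
  · refine ENNReal.mul_ne_top (ENNReal.rpow_ne_top_of_nonneg (by linarith) (by simp)) ?_
    exact ENNReal.mul_ne_top (by simp) (ENNReal.mul_ne_top (by simp) (by simp))
  intro μ _ F hF
  have hP := mx_meas μ F
  set P := mx μ F with hPdef
  have mI : ∀ Q : ℝ → ℝ≥0∞, Measurable Q → ∀ b : ℝ, Measurable (fun z : ℝ × ℝ =>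
      {l : ℝ | ENNReal.ofReal l < Q z.1}.indicator (fun l => ENNReal.ofReal (l ^ (b - 1))) z.2) := by
    intro Q hQ b
    have hm : MeasurableSet {z : ℝ × ℝ | ENNReal.ofReal z.2 < Q z.1} :=
      measurableSet_lt (by fun_prop) (by fun_prop)
    have : Measurable (fun z : ℝ × ℝ => {z : ℝ × ℝ | ENNReal.ofReal z.2 < Q z.1}.indicator
      (fun z => ENNReal.ofReal (z.2 ^ (b - 1))) z) := Measurable.indicator (by fun_prop) hm
    exact this
  have h1 : ENNReal.ofReal s⁻¹ * ∫⁻ x, (P x / 2) ^ s ∂μ =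
      ∫⁻ l in Ioi (0:ℝ), ENNReal.ofReal (l ^ (s - 1)) * μ {x | ENNReal.ofReal l < P x / 2} := by
    rw [← lintegral_const_mul _ (by fun_prop)]
    simp_rw [← layer s (by linarith)]
    rw [lintegral_lintegral_swap]
    · refine lintegral_congr fun l => ?_
      have hm : MeasurableSet {x | ENNReal.ofReal l < P x / 2} :=
        measurableSet_lt measurable_const (by fun_prop)
      rw [← lintegral_indicator_const hm]
      rfl
    · exact (mI (fun x => P x / 2) (by fun_prop) s).aemeasurable
  have h2 : ∀ l ∈ Ioi (0:ℝ), ENNReal.ofReal (l ^ (s - 1)) * μ {x | ENNReal.ofReal l < P x / 2} ≤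
      ∫⁻ x, 2 * (F x * {l : ℝ | ENNReal.ofReal l < F x}.indicator
        (fun l => ENNReal.ofReal (l ^ (s - 1 - 1))) l) ∂μ := by
    intro l hl
    have hl : 0 < l := hl
    have hm : MeasurableSet {y | ENNReal.ofReal l < F y} := measurableSet_lt measurable_const hF
    have a1 : {x | ENNReal.ofReal l < P x / 2} ⊆
        {x | ENNReal.ofReal l < mx μ ({y | ENNReal.ofReal l < F y}.indicator F) x} := by
      intro x hx
      have hx : ENNReal.ofReal l < P x / 2 := hx
      have := (ENNReal.mul_lt_of_lt_div hx).trans_le (mx_trunc μ F hF (ENNReal.ofReal l) x)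
      rw [mul_two] at this
      exact lt_of_add_lt_add_right this
    have a2 : ENNReal.ofReal (l ^ (s - 1)) = ENNReal.ofReal (l ^ (s - 1 - 1)) * ENNReal.ofReal l := by
      rw [← ENNReal.ofReal_mul (by positivity)]
      congr 1
      rw [Real.rpow_sub_one hl.ne' (s - 1)]
      field_simp
    calc _ ≤ ENNReal.ofReal (l ^ (s - 1 - 1)) * (ENNReal.ofReal l *
          μ {x | ENNReal.ofReal l < mx μ ({y | ENNReal.ofReal l < F y}.indicator F) x}) := by
          rw [a2, mul_assoc]
          gcongr
      _ ≤ ENNReal.ofReal (l ^ (s - 1 - 1)) * (2 * ∫⁻ x, {y | ENNReal.ofReal l < F y}.indicator F x ∂μ) := by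
          exact mul_le_mul_right (mx_weak μ _ (hF.indicator hm) _) _
      _ = _ := by
          rw [← mul_assoc, ← lintegral_const_mul _ (hF.indicator hm)]
          refine lintegral_congr fun x => ?_
          by_cases h : ENNReal.ofReal l < F x
          · simp [h]
            ring
          · simp [h]
  have h3 : ENNReal.ofReal s⁻¹ * ∫⁻ x, (P x / 2) ^ s ∂μ ≤
      (2 * ENNReal.ofReal (s - 1)⁻¹) * ∫⁻ x, F x ^ s ∂μ := by
    rw [h1]
    refine (setLIntegral_mono' measurableSet_Ioi h2).trans ?_
    rw [lintegral_lintegral_swap]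
    · rw [← lintegral_const_mul _ (by fun_prop)]
      refine lintegral_mono fun x => ?_
      have hmx : Measurable fun l : ℝ => {l : ℝ | ENNReal.ofReal l < F x}.indicator
          (fun l => ENNReal.ofReal (l ^ (s - 1 - 1))) l :=
        (mI F hF (s - 1)).comp (measurable_const.prodMk measurable_id)
      simp only
      rw [lintegral_const_mul _ (hmx.const_mul _), lintegral_const_mul _ hmx, layer (s-1) (by linarith)]
      have : F x ^ s = F x * F x ^ (s - 1) := by
        nth_rewrite 2 [← ENNReal.rpow_one (F x)]
        rw [← ENNReal.rpow_add_of_nonneg _ _ (by norm_num) (by linarith)]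
        congr 1
        ring
      rw [this]
      apply le_of_eq
      ring
    · have : Measurable (fun z : ℝ × ℝ => 2 * (F z.1 * {l : ℝ | ENNReal.ofReal l < F z.1}.indicator
        (fun l => ENNReal.ofReal (l ^ (s - 1 - 1))) z.2)) :=
        ((hF.comp measurable_fst).mul (mI F hF (s-1))).const_mul _
      exact (this.comp measurable_swap).aemeasurable
  have h4 : ∫⁻ x, P x ^ s ∂μ = 2 ^ s * (ENNReal.ofReal s *
      (ENNReal.ofReal s⁻¹ * ∫⁻ x, (P x / 2) ^ s ∂μ)) := by
    rw [← mul_assoc (ENNReal.ofReal s), ← ENNReal.ofReal_mul (by linarith),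
      mul_inv_cancel₀ (by linarith), ENNReal.ofReal_one, one_mul,
      ← lintegral_const_mul _ (by fun_prop)]
    refine lintegral_congr fun x => ?_
    rw [← ENNReal.mul_rpow_of_nonneg _ _ (by linarith), ENNReal.mul_div_cancel (by simp) (by simp)]
  rw [h4, mul_assoc, mul_assoc]
  gcongr

lemma pointwise (μ ν : Measure ℝ) [IsLocallyFiniteMeasure μ] [IsLocallyFiniteMeasure ν]
    (u : ℝ → ℝ≥0∞) (hu : Measurable u) (hu0 : ∀ x, u x ≠ 0) (hut : ∀ x, u x ≠ ∞)
    (hμ : μ = volume.withDensity u) (hna : ∀ x, μ {x} = 0) (hna' : ∀ x, ν {x} = 0)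
    (hpos : ∀ a b : ℝ, a < b → μ (Ioc a b) ≠ 0) (hpos' : ∀ a b : ℝ, a < b → ν (Ioc a b) ≠ 0)
    (r : ℝ) (hr : 1 < r) (K : ℝ≥0∞)
    (hK : ∀ x h : ℝ, 0 < h → μ (Ioc x (x + h)) * ν (Ioc (x - h) x) ^ (r - 1) ≤
      K * ENNReal.ofReal h ^ r)
    (φ : ℝ → ℝ≥0∞) (x h : ℝ) (hh : 0 < h) :
    ∫⁻ t in Ioc (x - h) x, φ t ∂ν ≤
      (K * mx μ (fun y => mx ν φ y ^ (r - 1) / u y) x) ^ (1 / (r - 1)) * ENNReal.ofReal h := by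
  set ψ := mx ν φ with hψ
  set D := mx μ (fun y => ψ y ^ (r - 1) / u y) x with hD
  have hψm : Measurable ψ := mx_meas ν φ
  have hI0 := hpos' (x - h) x (by linarith)
  have hIt : ν (Ioc (x - h) x) ≠ ∞ := measure_Ioc_lt_top.ne
  set A := (∫⁻ t in Ioc (x - h) x, φ t ∂ν) / ν (Ioc (x - h) x) with hA
  have hr1 : 0 < r - 1 := by linarith
  have hAψ : ∀ y ∈ Ioc (x - h) x, A ≤ ψ y := fun y hy => mx_ge ν hna' φ _ _ y hI0 hy
  have step : ∀ δ : ℝ, 0 < δ → δ ≤ h → A * ν (Ioc (x - 2 * δ) (x - δ)) ≤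
      (K * D) ^ (1 / (r - 1)) * ENNReal.ofReal δ := by
    intro δ hδ hδh
    have hδ0 : ENNReal.ofReal δ ≠ 0 := by simpa using hδ
    have b1 : A ^ (r - 1) * ENNReal.ofReal δ ≤ D * μ (Ioc (x - δ) x) := by
      have c1 := mx_ge μ hna (fun y => ψ y ^ (r - 1) / u y) (x - δ) x x
        (hpos _ _ (by linarith)) ⟨by linarith, le_rfl⟩
      rw [ENNReal.div_le_iff (hpos _ _ (by linarith)) measure_Ioc_lt_top.ne] at c1
      refine le_trans ?_ c1
      rw [hμ, restrict_withDensity measurableSet_Ioc,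
        lintegral_withDensity_eq_lintegral_mul _ hu (by fun_prop)]
      have : A ^ (r - 1) * ENNReal.ofReal δ = ∫⁻ t in Ioc (x - δ) x, A ^ (r - 1) := by
        rw [setLIntegral_const, Real.volume_Ioc]
        congr 2
        ring
      rw [this]
      refine setLIntegral_mono' measurableSet_Ioc fun y hy => ?_
      simp only [Pi.mul_apply]
      rw [ENNReal.mul_div_cancel (hu0 y) (hut y)]
      gcongr
      exact hAψ y ⟨by linarith [hy.1], hy.2⟩
    have b2 := hK (x - δ) δ hδ
    rw [sub_add_cancel, show x - δ - δ = x - 2 * δ by ring] at b2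
    set N := ν (Ioc (x - 2 * δ) (x - δ))
    have b3 : (A * N) ^ (r - 1) * ENNReal.ofReal δ ≤
        ((K * D) * ENNReal.ofReal δ ^ (r - 1)) * ENNReal.ofReal δ := by
      calc (A * N) ^ (r - 1) * ENNReal.ofReal δ = A ^ (r - 1) * ENNReal.ofReal δ * N ^ (r - 1) := by
            rw [ENNReal.mul_rpow_of_nonneg _ _ hr1.le]; ring
        _ ≤ D * μ (Ioc (x - δ) x) * N ^ (r - 1) := by gcongr
        _ = D * (μ (Ioc (x - δ) x) * N ^ (r - 1)) := by ring
        _ ≤ D * (K * ENNReal.ofReal δ ^ r) := by gcongr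
        _ = _ := by
            have : ENNReal.ofReal δ ^ r = ENNReal.ofReal δ ^ (r - 1) * ENNReal.ofReal δ := by
              nth_rewrite 3 [← ENNReal.rpow_one (ENNReal.ofReal δ)]
              rw [← ENNReal.rpow_add _ _ hδ0 (by simp), sub_add_cancel]
            rw [this]; ring
    have b4 : (A * N) ^ (r - 1) ≤ (K * D) * ENNReal.ofReal δ ^ (r - 1) :=
      (ENNReal.mul_le_mul_iff_left hδ0 (by simp)).1 b3
    have b5 := ENNReal.rpow_le_rpow b4 (show 0 ≤ 1 / (r - 1) by positivity)
    rw [ENNReal.mul_rpow_of_nonneg (K * D) _ (by positivity), ← ENNReal.rpow_mul, ← ENNReal.rpow_mul,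
      mul_one_div_cancel hr1.ne', ENNReal.rpow_one, ENNReal.rpow_one] at b5
    exact b5
  have hcov : Ioc (x - h) x ⊆ {x} ∪ ⋃ k : ℕ, Ioc (x - 2 * (h / 2 / 2 ^ k)) (x - h / 2 / 2 ^ k) := by
    intro y hy
    rcases eq_or_lt_of_le hy.2 with hyx | hyx
    · exact Or.inl hyx
    right
    have hex : ∃ n : ℕ, h / 2 ^ n ≤ x - y := by
      obtain ⟨n, hn⟩ := pow_unbounded_of_one_lt (h / (x - y)) (show (1:ℝ) < 2 by norm_num)
      refine ⟨n, ?_⟩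
      have : 0 < x - y := by linarith
      rw [div_lt_iff₀ this] at hn
      rw [div_le_iff₀ (by positivity)]
      linarith
    classical
    have f1 := Nat.find_spec hex
    obtain ⟨k, hk⟩ : ∃ k, Nat.find hex = k + 1 := by
      refine Nat.exists_eq_succ_of_ne_zero fun h0 => ?_
      rw [h0] at f1
      have := hy.1
      norm_num at f1
      linarith
    have f2 := Nat.find_min hex (show k < Nat.find hex by omega)
    rw [hk, pow_succ'] at f1
    rw [← div_div] at f1
    refine mem_iUnion.2 ⟨k, ?_, by linarith⟩
    have : 2 * (h / 2 / 2 ^ k) = h / 2 ^ k := by ring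
    rw [this]
    linarith
  calc ∫⁻ t in Ioc (x - h) x, φ t ∂ν = A * ν (Ioc (x - h) x) :=
        (ENNReal.div_mul_cancel hI0 hIt).symm
    _ ≤ A * ∑' k : ℕ, ν (Ioc (x - 2 * (h / 2 / 2 ^ k)) (x - h / 2 / 2 ^ k)) := by
        gcongr
        refine (measure_mono hcov).trans ((measure_union_le _ _).trans ?_)
        rw [hna', zero_add]
        exact measure_iUnion_le _
    _ = ∑' k : ℕ, A * ν (Ioc (x - 2 * (h / 2 / 2 ^ k)) (x - h / 2 / 2 ^ k)) := ENNReal.tsum_mul_left.symm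
    _ ≤ ∑' k : ℕ, (K * D) ^ (1 / (r - 1)) * ENNReal.ofReal (h / 2 / 2 ^ k) := by
        refine ENNReal.tsum_le_tsum fun k => step _ (by positivity) ?_
        have : (1:ℝ) ≤ 2 ^ k := one_le_pow₀ (by norm_num)
        rw [div_div, div_le_iff₀ (by positivity)]
        nlinarith
    _ = (K * D) ^ (1 / (r - 1)) * ENNReal.ofReal h := by
        rw [ENNReal.tsum_mul_left, ← ENNReal.ofReal_tsum_of_nonneg (fun k => by positivity)
          (summable_geometric_two' h), tsum_geometric_two']

lemma dens_pos (u : ℝ → ℝ≥0∞) (hu : Measurable u) (hu0 : ∀ x, u x ≠ 0) (a b : ℝ) (hab : a < b) :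
    volume.withDensity u (Ioc a b) ≠ 0 := by
  rw [withDensity_apply _ measurableSet_Ioc]
  intro h
  rw [lintegral_eq_zero_iff hu] at h
  have h2 : ∀ᵐ x ∂(volume.restrict (Ioc a b)), False := by
    filter_upwards [h] with x hx
    exact hu0 x hx
  rw [ae_iff] at h2
  simp at h2
  linarith

lemma dens_lf (u : ℝ → ℝ≥0∞) (h : ∀ a b : ℝ, a < b → volume.withDensity u (Ioc a b) ≠ ∞) :
    IsLocallyFiniteMeasure (volume.withDensity u) :=
  ⟨fun x => ⟨Ioc (x - 1) (x + 1), Ioc_mem_nhds (by linarith) (by linarith),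
    (h _ _ (by linarith)).lt_top⟩⟩

lemma dens_na (u : ℝ → ℝ≥0∞) (x : ℝ) : volume.withDensity u {x} = 0 :=
  withDensity_absolutelyContinuous _ _ (by simp)

lemma lint_dens (u g : ℝ → ℝ≥0∞) (hu : Measurable u) (hg : Measurable g) :
    ∫⁻ x, g x ∂(volume.withDensity u) = ∫⁻ x, u x * g x := by
  rw [lintegral_withDensity_eq_lintegral_mul _ hu hg]
  rfl

/-- strong one-sided estimate in dominated form -/
lemma buckley (r : ℝ) (hr : 1 < r) : ∃ C : ℝ≥0∞, C ≠ ∞ ∧ ∀ (u σ g : ℝ → ℝ≥0∞) (K : ℝ≥0∞),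
    Measurable u → Measurable σ → Measurable g → (∀ x, u x ≠ 0) → (∀ x, u x ≠ ∞) →
    (∀ x, σ x = u x ^ (-(1 / (r - 1)))) → K ≠ ∞ →
    (∀ x h : ℝ, 0 < h → (∫⁻ t in Ioc x (x + h), u t) * (∫⁻ t in Ioc (x - h) x, σ t) ^ (r - 1) ≤
      K * ENNReal.ofReal h ^ r) →
    ∃ D : ℝ → ℝ≥0∞, Measurable D ∧
      (∀ x h : ℝ, 0 < h → ∫⁻ t in Ioc (x - h) x, g t ≤ D x * ENNReal.ofReal h) ∧
      ∫⁻ x, D x ^ r * u x ≤ C * K ^ (r / (r - 1)) * ∫⁻ x, g x ^ r * u x := by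
  have hr1 : 0 < r - 1 := by linarith
  obtain ⟨C1, hC1, H1⟩ := mx_strong r hr
  obtain ⟨C2, hC2, H2⟩ := mx_strong (r / (r - 1)) (by rw [lt_div_iff₀ hr1]; linarith)
  refine ⟨C2 * C1, ENNReal.mul_ne_top hC2 hC1, ?_⟩
  intro u σ g K hu hσ hg hu0 hut hσu hKt hK
  have hσ0 : ∀ x, σ x ≠ 0 := fun x => by
    rw [hσu]; simp [ENNReal.rpow_eq_zero_iff, hu0, hut]
  have hσt : ∀ x, σ x ≠ ∞ := fun x => by
    rw [hσu]; simp [ENNReal.rpow_eq_top_iff, hu0, hut]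
  set μ := volume.withDensity u with hμ
  set ν := volume.withDensity σ with hν
  have hK' : ∀ x h : ℝ, 0 < h → μ (Ioc x (x + h)) * ν (Ioc (x - h) x) ^ (r - 1) ≤
      K * ENNReal.ofReal h ^ r := by
    intro x h hh
    rw [hμ, hν, withDensity_apply _ measurableSet_Ioc, withDensity_apply _ measurableSet_Ioc]
    exact hK x h hh
  have hpos := dens_pos u hu hu0
  have hpos' := dens_pos σ hσ hσ0
  have hfin : ∀ x h : ℝ, 0 < h → μ (Ioc x (x + h)) * ν (Ioc (x - h) x) ^ (r - 1) ≠ ∞ := by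
    intro x h hh
    refine ne_top_of_le_ne_top ?_ (hK' x h hh)
    exact ENNReal.mul_ne_top hKt (ENNReal.rpow_ne_top_of_nonneg (by linarith) (by simp))
  have : IsLocallyFiniteMeasure μ := by
    refine dens_lf u fun a b hab h => ?_
    apply hfin a (b - a) (by linarith)
    rw [show a + (b - a) = b by ring, hμ, h]
    refine ENNReal.top_mul ?_
    rw [Ne, ENNReal.rpow_eq_zero_iff_of_pos hr1]
    exact hpos' _ _ (by linarith)
  have : IsLocallyFiniteMeasure ν := by
    refine dens_lf σ fun a b hab h => ?_
    apply hfin b (b - a) (by linarith)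
    rw [show b - (b - a) = a by ring, hν, h, ENNReal.top_rpow_of_pos hr1]
    exact ENNReal.mul_top (hpos _ _ (by linarith))
  set φ : ℝ → ℝ≥0∞ := fun x => g x / σ x with hφ
  have hφm : Measurable φ := hg.div hσ
  have hψm := mx_meas ν φ
  set G : ℝ → ℝ≥0∞ := fun y => mx ν φ y ^ (r - 1) / u y with hG
  have hGm : Measurable G := by fun_prop
  have hDm := mx_meas μ G
  refine ⟨fun x => (K * mx μ G x) ^ (1 / (r - 1)), by fun_prop, ?_, ?_⟩
  · intro x h hh
    refine le_trans (le_of_eq ?_) (pointwise μ ν u hu hu0 hut rfl (dens_na u) (dens_na σ)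
      hpos hpos' r hr K hK' φ x h hh)
    rw [hν, restrict_withDensity measurableSet_Ioc, lintegral_withDensity_eq_lintegral_mul _ hσ hφm]
    refine lintegral_congr fun y => ?_
    simp only [Pi.mul_apply, hφ]
    rw [ENNReal.mul_div_cancel (hσ0 y) (hσt y)]
  · have hrr : 0 ≤ r / (r - 1) := by positivity
    have e1 : ∫⁻ x, ((K * mx μ G x) ^ (1 / (r - 1))) ^ r * u x =
        K ^ (r / (r - 1)) * ∫⁻ x, mx μ G x ^ (r / (r - 1)) ∂μ := by
      rw [hμ, lint_dens _ _ hu (by fun_prop), ← lintegral_const_mul _ (by fun_prop)]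
      refine lintegral_congr fun x => ?_
      rw [← ENNReal.rpow_mul, one_div_mul_eq_div, ENNReal.mul_rpow_of_nonneg _ _ hrr]
      ring
    have e2 : ∫⁻ x, G x ^ (r / (r - 1)) ∂μ = ∫⁻ x, mx ν φ x ^ r ∂ν := by
      rw [hμ, lint_dens _ _ hu (by fun_prop)]
      conv_rhs => rw [hν, lint_dens _ _ hσ (by fun_prop)]
      refine lintegral_congr fun x => ?_
      simp only [hG]
      rw [ENNReal.div_rpow_of_nonneg _ _ hrr, ← ENNReal.rpow_mul, mul_div_cancel₀ _ hr1.ne',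
        div_eq_mul_inv, ← ENNReal.rpow_neg, mul_left_comm, mul_comm]
      congr 1
      rw [hσu]
      nth_rewrite 1 [← ENNReal.rpow_one (u x)]
      rw [← ENNReal.rpow_add _ _ (hu0 x) (hut x)]
      congr 1
      field_simp
      ring
    have e3 : ∫⁻ x, φ x ^ r ∂ν = ∫⁻ x, g x ^ r * u x := by
      rw [hν, lint_dens _ _ hσ (by fun_prop)]
      refine lintegral_congr fun x => ?_
      simp only [hφ]
      rw [ENNReal.div_rpow_of_nonneg _ _ (by linarith), div_eq_mul_inv, ← ENNReal.rpow_neg,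
        mul_left_comm]
      congr 1
      rw [hσu]
      nth_rewrite 1 [← ENNReal.rpow_one (u x ^ (-(1 / (r - 1))))]
      rw [← ENNReal.rpow_add _ _ (by rw [← hσu]; exact hσ0 x) (by rw [← hσu]; exact hσt x),
        ← ENNReal.rpow_mul]
      nth_rewrite 2 [← ENNReal.rpow_one (u x)]
      congr 1
      field_simp
      ring
    rw [e1, ← e3]
    calc K ^ (r / (r - 1)) * ∫⁻ x, mx μ G x ^ (r / (r - 1)) ∂μ
        ≤ K ^ (r / (r - 1)) * (C2 * (C1 * ∫⁻ x, φ x ^ r ∂ν)) := by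
          gcongr
          refine (H2 μ G hGm).trans ?_
          rw [e2]
          gcongr
          exact H1 ν φ hφm
      _ = _ := by ring

lemma main_meas (p q α : ℝ) (hα : 0 < α) (hα1 : α < 1) (hp : 1 < p) (hpα : p < 1 / α)
    (hq : 1 / p - 1 / q - α = 0) :
    ∃ C : ℝ≥0∞, C ≠ ∞ ∧ ∀ (W F : ℝ → ℝ≥0∞) (K : ℝ≥0∞), Measurable W → Measurable F →
      (∀ x, W x ≠ 0) → (∀ x, W x ≠ ∞) → K ≠ ∞ →
      (∀ x h : ℝ, 0 < h → (∫⁻ t in Ioc x (x + h), W t ^ q) *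
        (∫⁻ t in Ioc (x - h) x, W t ^ (-(p / (p - 1)))) ^ (q / (p / (p - 1))) ≤
          K * ENNReal.ofReal h ^ (q * (1 - α))) →
      (∫⁻ x, (⨆ (h : ℝ) (_ : 0 < h), ENNReal.ofReal (h ^ (α - 1)) *
        ∫⁻ t in Ioc (x - h) x, F t) ^ q * W x ^ q) ^ (1 / q) ≤
      C * K ^ ((p / (p - 1)) / q * (1 - α)) * (∫⁻ x, F x ^ p * W x ^ p) ^ (1 / p) := by
  have hp0 : 0 < p := by linarith
  have hp1 : 0 < p - 1 := by linarith
  have hq0 : 0 < q := by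
    have : α < 1 / p := by
      rw [lt_div_iff₀ hp0]
      rw [lt_div_iff₀ hα] at hpα
      linarith
    have : 0 < 1 / q := by linarith
    exact one_div_pos.1 this
  have hrel : q - p = α * p * q := by
    field_simp at hq
    linarith
  set r := q * (1 - α) with hr
  have hα2 : 0 < 1 - α := by linarith
  have hr0 : 0 < r := by positivity
  have hr1 : r - 1 = q / (p / (p - 1)) := by
    rw [hr]
    field_simp
    linarith
  have hr1' : 0 < r - 1 := by rw [hr1]; positivity
  obtain ⟨C, hC, H⟩ := buckley r (by linarith)
  refine ⟨C ^ (1 / q), ENNReal.rpow_ne_top_of_nonneg (by positivity) hC, ?_⟩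
  intro W F K hW hF hW0 hWt hKt hK
  set g : ℝ → ℝ≥0∞ := fun x => F x ^ (p / r) * W x ^ ((p - q) / r) with hg
  have hgm : Measurable g := by fun_prop
  rw [← hr1] at hK
  obtain ⟨D, hDm, hD1, hD2⟩ := H (fun x => W x ^ q) (fun x => W x ^ (-(p / (p - 1)))) g K
    (by fun_prop) (by fun_prop) hgm
    (fun x => by simp [ENNReal.rpow_eq_zero_iff, hW0, hWt])
    (fun x => by simp [ENNReal.rpow_eq_top_iff, hW0, hWt])
    (fun x => by
      rw [← ENNReal.rpow_mul, hr1]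
      congr 1
      field_simp) hKt hK
  set N := ∫⁻ x, F x ^ p * W x ^ p with hN
  have hgr : ∀ x, g x ^ r * W x ^ q = F x ^ p * W x ^ p := by
    intro x
    simp only [hg]
    rw [ENNReal.mul_rpow_of_nonneg _ _ hr0.le, ← ENNReal.rpow_mul, ← ENNReal.rpow_mul,
      div_mul_cancel₀ _ hr0.ne', div_mul_cancel₀ _ hr0.ne', mul_assoc,
      ← ENNReal.rpow_add _ _ (hW0 x) (hWt x), sub_add_cancel]
  have hFg : ∀ x, F x = g x ^ (1 - α) * (F x ^ p * W x ^ p) ^ α := by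
    intro x
    simp only [hg]
    rw [ENNReal.mul_rpow_of_nonneg _ _ hα2.le, ENNReal.mul_rpow_of_nonneg _ _ hα.le,
      ← ENNReal.rpow_mul, ← ENNReal.rpow_mul, ← ENNReal.rpow_mul, ← ENNReal.rpow_mul,
      mul_mul_mul_comm, ← ENNReal.rpow_add_of_nonneg _ _ (by positivity) (by positivity),
      ← ENNReal.rpow_add _ _ (hW0 x) (hWt x)]
    have e1 : p / r * (1 - α) + p * α = 1 := by
      rw [hr]; field_simp; linarith
    have e2 : (p - q) / r * (1 - α) + p * α = 0 := by
      rw [hr]; field_simp; linarith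
    rw [e1, e2]
    simp
  have hM : ∀ x, (⨆ (h : ℝ) (_ : 0 < h), ENNReal.ofReal (h ^ (α - 1)) *
        ∫⁻ t in Ioc (x - h) x, F t) ≤ D x ^ (1 - α) * N ^ α := by
    intro x
    refine iSup₂_le fun h hh => ?_
    have hh0 : ENNReal.ofReal h ≠ 0 := by simpa using hh
    calc ENNReal.ofReal (h ^ (α - 1)) * ∫⁻ t in Ioc (x - h) x, F t
        = ENNReal.ofReal (h ^ (α - 1)) *
          ∫⁻ t in Ioc (x - h) x, g t ^ (1 - α) * (F t ^ p * W t ^ p) ^ α := by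
          congr 1
          exact lintegral_congr hFg
      _ ≤ ENNReal.ofReal (h ^ (α - 1)) * ((∫⁻ t in Ioc (x - h) x, g t) ^ (1 - α) *
          (∫⁻ t in Ioc (x - h) x, F t ^ p * W t ^ p) ^ α) := by
          gcongr
          exact ENNReal.lintegral_mul_norm_pow_le hgm.aemeasurable (by fun_prop) hα2.le hα.le
            (by ring)
      _ ≤ ENNReal.ofReal (h ^ (α - 1)) * ((D x * ENNReal.ofReal h) ^ (1 - α) * N ^ α) := by
          gcongr
          · exact hD1 x h hh
          · exact setLIntegral_le_lintegral _ _
      _ = D x ^ (1 - α) * N ^ α := by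
          rw [ENNReal.mul_rpow_of_nonneg _ _ hα2.le, ← ENNReal.ofReal_rpow_of_pos hh,
            show α - 1 = -(1 - α) by ring, ENNReal.rpow_neg]
          have h1 : ENNReal.ofReal h ^ (1 - α) ≠ 0 := by
            simp [ENNReal.rpow_eq_zero_iff, hh]
          have h2 : ENNReal.ofReal h ^ (1 - α) ≠ ∞ :=
            ENNReal.rpow_ne_top_of_nonneg hα2.le (by simp)
          rw [show ∀ a b c d : ℝ≥0∞, a * (b * c * d) = (a * c) * (b * d) by intros; ring,
            ENNReal.inv_mul_cancel h1 h2, one_mul]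
  have hL : ∫⁻ x, (⨆ (h : ℝ) (_ : 0 < h), ENNReal.ofReal (h ^ (α - 1)) *
        ∫⁻ t in Ioc (x - h) x, F t) ^ q * W x ^ q ≤ C * K ^ (r / (r - 1)) * N ^ (1 + α * q) := by
    calc _ ≤ ∫⁻ x, N ^ (α * q) * (D x ^ r * W x ^ q) := by
          refine lintegral_mono fun x => ?_
          refine (mul_le_mul_left (ENNReal.rpow_le_rpow (hM x) hq0.le) _).trans (le_of_eq ?_)
          rw [ENNReal.mul_rpow_of_nonneg _ _ hq0.le, ← ENNReal.rpow_mul, ← ENNReal.rpow_mul,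
            show (1 - α) * q = r by rw [hr]; ring]
          ring
      _ = N ^ (α * q) * ∫⁻ x, D x ^ r * W x ^ q := lintegral_const_mul _ (by fun_prop)
      _ ≤ N ^ (α * q) * (C * K ^ (r / (r - 1)) * N) := by
          gcongr
          refine hD2.trans (le_of_eq ?_)
          congr 1
          exact lintegral_congr hgr
      _ = _ := by
          rw [ENNReal.rpow_add_of_nonneg _ _ (by norm_num) (by positivity), ENNReal.rpow_one]
          ring
  refine (ENNReal.rpow_le_rpow hL (by positivity)).trans (le_of_eq ?_)
  rw [ENNReal.mul_rpow_of_nonneg _ _ (by positivity), ENNReal.mul_rpow_of_nonneg _ _ (by positivity),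
    ← ENNReal.rpow_mul, ← ENNReal.rpow_mul]
  congr 2
  · congr 1
    rw [hr1, hr]
    field_simp
  · field_simp
    linarith

/-- Sharp one-weight bound for `M⁻_α`:
`‖w M⁻_α f‖_{L^q} ≤ c ‖w‖_{A_{p,q}^-}^{(p'/q)(1-α)} ‖wf‖_{L^p}`, i.e.
`‖M⁻_α‖_{L^p_{w^p} → L^q_{w^q}} ≤ c ‖w‖_{A_{p,q}^-}^{(p'/q)(1-α)}`. -/
theorem stmt9 (p q α : ℝ) (hα : 0 < α) (hα1 : α < 1) (hp : 1 < p) (hpα : p < 1 / α)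
    (hq : 1 / p - 1 / q - α = 0) :
    ∃ c : ℝ, 0 < c ∧
      ∀ w : ℝ → ℝ, IsWeight w → apqMinusChar p q w ≠ ∞ →
        ∀ f : ℝ → ℝ,
          lnormW q (fun x => w x ^ q) (MminusAlpha α f) ≤
            ENNReal.ofReal c * apqMinusChar p q w ^ ((p / (p - 1)) / q * (1 - α)) *
              lnormW p (fun x => w x ^ p) (fun x => ENNReal.ofReal |f x|) := by
  obtain ⟨C, hC, H⟩ := main_meas p q α hα hα1 hp hpα hq
  refine ⟨C.toReal + 1, by positivity, ?_⟩
  intro w hw hK f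
  have hp0 : 0 < p := by linarith
  have hp1 : 0 < p - 1 := by linarith
  have hq0 : 0 < q := by
    have : α < 1 / p := by
      rw [lt_div_iff₀ hp0]
      rw [lt_div_iff₀ hα] at hpα
      linarith
    have : 0 < 1 / q := by linarith
    exact one_div_pos.1 this
  have hrel : q - p = α * p * q := by
    field_simp at hq
    linarith
  have hr1 : q * (1 - α) = 1 + q / (p / (p - 1)) := by
    field_simp
    linarith
  have hs : 0 < q / (p / (p - 1)) := by positivity
  obtain ⟨F, hFm, hFle, hFint⟩ := ex_minorant (fun x => ENNReal.ofReal |f x|)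
  have hwm : AEStronglyMeasurable w volume := hw.2.aestronglyMeasurable
  set w1 := hwm.mk w with hw1
  have hw1m : Measurable w1 := hwm.stronglyMeasurable_mk.measurable
  set W : ℝ → ℝ≥0∞ := fun x => if 0 < w1 x then ENNReal.ofReal (w1 x) else 1 with hW
  have hWm : Measurable W :=
    Measurable.ite (measurableSet_lt measurable_const hw1m) (by fun_prop) measurable_const
  have hW0 : ∀ x, W x ≠ 0 := by
    intro x
    simp only [hW]
    split_ifs with h
    · simpa using h
    · simp
  have hWt : ∀ x, W x ≠ ∞ := by
    intro x
    simp only [hW]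
    split_ifs with h <;> simp
  have hae : ∀ᵐ x, ∀ b : ℝ, ENNReal.ofReal (w x ^ b) = W x ^ b := by
    filter_upwards [hw.1, hwm.ae_eq_mk] with x h1 h2 b
    have h3 : w1 x = w x := h2.symm
    simp only [hW, h3, h1, if_true]
    rw [ENNReal.ofReal_rpow_of_pos h1]
  have hint : ∀ (b : ℝ) (s : Set ℝ), ∫⁻ t in s, ENNReal.ofReal (w t ^ b) = ∫⁻ t in s, W t ^ b :=
    fun b s => lintegral_congr_ae (ae_restrict_of_ae (hae.mono fun x hx => hx b))
  have key := H W F (apqMinusChar p q w) hWm hFm hW0 hWt hK (by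
    intro x h hh
    have hh0 : ENNReal.ofReal h ≠ 0 := by simpa using hh
    have h1 : avgIoc (fun t => w t ^ q) x (x + h) *
      avgIoc (fun t => w t ^ (-(p / (p - 1)))) (x - h) x ^ (q / (p / (p - 1))) ≤
        apqMinusChar p q w :=
      le_iSup_of_le x (le_iSup_of_le h (le_iSup_of_le hh le_rfl))
    unfold avgIoc lintIoc at h1
    rw [hint, hint, show x + h - x = h by ring, show x - (x - h) = h by ring] at h1
    set a := ∫⁻ t in Ioc x (x + h), W t ^ q
    set b := ∫⁻ t in Ioc (x - h) x, W t ^ (-(p / (p - 1)))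
    refine le_trans (le_of_eq ?_) (mul_le_mul_left h1 _)
    rw [hr1, ENNReal.rpow_add_of_nonneg _ _ (by norm_num) hs.le, ENNReal.rpow_one,
      ENNReal.mul_rpow_of_nonneg _ _ hs.le, ENNReal.inv_rpow]
    set s := q / (p / (p - 1))
    have h3 : ENNReal.ofReal h ^ s ≠ 0 := by
      simp [ENNReal.rpow_eq_zero_iff, hh]
    have h4 : ENNReal.ofReal h ^ s ≠ ∞ := ENNReal.rpow_ne_top_of_nonneg hs.le (by simp)
    rw [show ∀ i a j b k l : ℝ≥0∞, i * a * (j * b) * (k * l) = (i * k) * (j * l) * (a * b) by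
      intros; ring, ENNReal.inv_mul_cancel hh0 (by simp), ENNReal.inv_mul_cancel h3 h4, one_mul,
      one_mul])
  have hL : lnormW q (fun x => w x ^ q) (MminusAlpha α f) ≤
      (∫⁻ x, (⨆ (h : ℝ) (_ : 0 < h), ENNReal.ofReal (h ^ (α - 1)) *
        ∫⁻ t in Ioc (x - h) x, F t) ^ q * W x ^ q) ^ (1 / q) := by
    unfold lnormW MminusAlpha
    refine ENNReal.rpow_le_rpow (lintegral_mono_ae ?_) (by positivity)
    filter_upwards [hae] with x hx
    rw [hx q]
    refine mul_le_mul_left (ENNReal.rpow_le_rpow ?_ hq0.le) _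
    exact iSup₂_mono fun h _ => mul_le_mul_right (hFint _ _) _
  have hR : (∫⁻ x, F x ^ p * W x ^ p) ^ (1 / p) ≤
      lnormW p (fun x => w x ^ p) (fun x => ENNReal.ofReal |f x|) := by
    unfold lnormW
    refine ENNReal.rpow_le_rpow (lintegral_mono_ae ?_) (by positivity)
    filter_upwards [hae] with x hx
    rw [hx p]
    gcongr
    exact hFle x
  refine hL.trans (key.trans ?_)
  gcongr
  rw [← ENNReal.ofReal_toReal hC]
  refine ENNReal.ofReal_le_ofReal ?_
  simp

end
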